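/- Define d(m, n, k) recursively by d(m, 0, k) = 1, d(m, n, k) = m·d(m, n−1, k) + d(m+1, n−1, k) if m < k, and d(m, n, k) = m·d(m, n−1, k) if m = k. Then for a set X with |X| = k, the number of orbits of X^n under the diagonal Sym(X)-action equals d(0, n, k). -/

import Mathlib

open Quandles

/-- The setoid on `n`-tuples whose classes are orbits of the diagonal action
of the full symmetric group `X ≃ X`. -/
def symOrbit (X : Type*) (n : ℕ) : Setoid (Fin n → X) where
  r x y := ∃ π : X ≃ X, ∀ i, π (x i) = y i
  iseqv := by
    refine ⟨fun x => ⟨Equiv.refl X, fun i => rfl⟩, ?_, ?_⟩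
    · rintro x y ⟨π, h⟩
      exact ⟨π.symm, fun i => by rw [← h i, Equiv.symm_apply_apply]⟩
    · rintro x y z ⟨π, h⟩ ⟨σ, h'⟩
      exact ⟨π.trans σ, fun i => by simp [Equiv.trans_apply, h i, h' i]⟩

/-- The recursively defined orbit count `d m n k`. -/
def d : ℕ → ℕ → ℕ → ℕ
  | _, 0, _ => 1
  | m, n + 1, k => if m < k then m * d m n k + d (m + 1) n k else m * d m n k

/-- The setoid on `n`-tuples whose classes are orbits of the diagonal action
of the permutations of `X` fixing `S` pointwise. -/
def fixingOrbit {X : Type*} (S : Finset X) (n : ℕ) : Setoid (Fin n → X) where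
  r x y := ∃ π : X ≃ X, (∀ s ∈ S, π s = s) ∧ ∀ i, π (x i) = y i
  iseqv := by
    refine ⟨fun x => ⟨Equiv.refl X, fun _ _ => rfl, fun _ => rfl⟩, ?_, ?_⟩
    · rintro x y ⟨π, hS, h⟩
      exact ⟨π.symm, fun s hs => by rw [Equiv.symm_apply_eq, hS s hs],
        fun i => by rw [← h i, Equiv.symm_apply_apply]⟩
    · rintro x y z ⟨π, hS, h⟩ ⟨σ, hS', h'⟩
      exact ⟨π.trans σ, fun s hs => by simp [hS s hs, hS' s hs], fun i => by simp [h i, h' i]⟩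

/-- Prepending `a` to a tuple, as a map from orbits of permutations fixing `insert a S`
to orbits of permutations fixing `S`. -/
def consOrbit {X : Type*} [DecidableEq X] (S : Finset X) (n : ℕ) (a : X) :
    Quotient (fixingOrbit (insert a S) n) → Quotient (fixingOrbit S (n + 1)) :=
  Quotient.map (fun x => Fin.cons a x) (by
    rintro x y ⟨π, hS, h⟩
    refine ⟨π, fun s hs => hS s (Finset.mem_insert_of_mem hs), Fin.cases ?_ ?_⟩
    · simpa using hS a (Finset.mem_insert_self a S)
    · simpa using h)

/-- If `R` is a transversal for the orbits on `X` of the permutations fixing `S`, then an orbit of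
`(n + 1)`-tuples is the choice of `r ∈ R` and an orbit of `n`-tuples relative to `insert r S`. -/
theorem consOrbit_bijective {X : Type*} [DecidableEq X] {S R : Finset X} (n : ℕ)
    (exists_rep : ∀ x, ∃ r ∈ R, ∃ π : X ≃ X, (∀ s ∈ S, π s = s) ∧ π x = r)
    (rep_unique : ∀ r ∈ R, ∀ r' ∈ R, ∀ π : X ≃ X, (∀ s ∈ S, π s = s) → π r = r' → r = r') :
    Function.Bijective
      (fun p : Σ r : R, Quotient (fixingOrbit (insert r.1 S) n) => consOrbit S n p.1.1 p.2) := by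
  constructor
  · rintro ⟨⟨a, ha⟩, p⟩ ⟨⟨b, hb⟩, q⟩ hpq
    induction p using Quotient.inductionOn with | _ x
    induction q using Quotient.inductionOn with | _ y
    obtain ⟨π, hS, h⟩ := Quotient.exact hpq
    have h0 : π a = b := by simpa using h 0
    obtain rfl := rep_unique a ha b hb π hS h0
    congr 1
    refine Quotient.sound ⟨π, ?_, fun i => by simpa using h i.succ⟩
    intro s hs
    rcases Finset.mem_insert.1 hs with rfl | hs
    · exact h0
    · exact hS s hs
  · intro q
    induction q using Quotient.inductionOn with | _ x
    obtain ⟨r, hr, π, hS, h⟩ := exists_rep (x 0)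
    refine ⟨⟨⟨r, hr⟩, Quotient.mk _ fun i => π (x i.succ)⟩, ?_⟩
    refine Eq.symm (Quotient.sound ⟨π, hS, Fin.cases ?_ ?_⟩)
    · simpa using h
    · simp

theorem card_fixingOrbit {X : Type*} [Fintype X] [DecidableEq X] (n : ℕ) (S : Finset X) :
    Nat.card (Quotient (fixingOrbit S n)) = d S.card n (Fintype.card X) := by
  induction n generalizing S with
  | zero =>
    have : Subsingleton (Quotient (fixingOrbit S 0)) := Quotient.instSubsingletonQuotient _
    have : Nonempty (Quotient (fixingOrbit S 0)) := ⟨Quotient.mk _ Fin.elim0⟩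
    simp [d]
  | succ n ih =>
    have card_eq_sum : ∀ R : Finset X,
        (∀ x, ∃ r ∈ R, ∃ π : X ≃ X, (∀ s ∈ S, π s = s) ∧ π x = r) →
        (∀ r ∈ R, ∀ r' ∈ R, ∀ π : X ≃ X, (∀ s ∈ S, π s = s) → π r = r' → r = r') →
        Nat.card (Quotient (fixingOrbit S (n + 1))) =
          ∑ r ∈ R, d (insert r S).card n (Fintype.card X) := by
      intro R exists_rep rep_unique
      rw [← Nat.card_eq_of_bijective _ (consOrbit_bijective n exists_rep rep_unique),
        Nat.card_sigma, ← Finset.sum_coe_sort R]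
      exact Finset.sum_congr rfl fun r _ => ih _
    have sum_self : ∑ r ∈ S, d (insert r S).card n (Fintype.card X) =
        S.card * d S.card n (Fintype.card X) := by
      rw [Finset.sum_congr rfl fun r hr => by rw [Finset.insert_eq_of_mem hr]]
      simp
    rw [d]
    split_ifs with hlt
    · obtain ⟨a, ha⟩ : ∃ a, a ∉ S := by
        by_contra! hS
        exact hlt.ne (Finset.card_eq_iff_eq_univ S |>.2 (Finset.eq_univ_of_forall hS))
      rw [card_eq_sum (insert a S), Finset.sum_insert ha, sum_self,
        Finset.card_insert_of_notMem ha, add_comm]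
      · intro x
        by_cases hx : x ∈ S
        · exact ⟨x, Finset.mem_insert_of_mem hx, Equiv.refl X, fun _ _ => rfl, rfl⟩
        · refine ⟨a, Finset.mem_insert_self a S, Equiv.swap x a, fun s hs => ?_,
            Equiv.swap_apply_left x a⟩
          exact Equiv.swap_apply_of_ne_of_ne (ne_of_mem_of_not_mem hs hx)
            (ne_of_mem_of_not_mem hs ha)
      · intro r hr r' hr' π hS h
        rcases Finset.mem_insert.1 hr with rfl | hr
        · rcases Finset.mem_insert.1 hr' with rfl | hr'
          · rfl
          · exact π.injective (h.trans (hS r' hr').symm)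
        · exact (hS r hr).symm.trans h
    · have hS : S = Finset.univ :=
        (Finset.card_eq_iff_eq_univ S).1 (le_antisymm (Finset.card_le_univ S) (not_lt.1 hlt))
      have mem_S : ∀ x, x ∈ S := fun x => hS ▸ Finset.mem_univ x
      rw [card_eq_sum S, sum_self]
      · exact fun x => ⟨x, mem_S x, Equiv.refl X, fun _ _ => rfl, rfl⟩
      · exact fun r hr r' _ π hfix h => (hfix r hr).symm.trans h

/-- The number of `Sym(X)`-orbits on `X^n` for `|X| = k ≥ 1` is `d 0 n k`. -/
theorem stmt3 (X : Type*) [Fintype X] (n k : ℕ) (hk : Fintype.card X = k)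
    (h1 : 1 ≤ k) :
    Nat.card (Quotient (symOrbit X n)) = d 0 n k := by
  classical
  subst hk
  have h : symOrbit X n = fixingOrbit ∅ n := by
    ext x y
    change (∃ π : X ≃ X, _) ↔ ∃ π : X ≃ X, _
    simp
  rw [h, card_fixingOrbit, Finset.card_empty]
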